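/- arXiv:2005.08185 — 3 statements merged into one kernel-verified Lean document; each statement's English description precedes it below -/
import Mathlib

section
/- Suppose q | m. Then 𝔠 = χ(α·γ̄)·R_q(n₂ − n₁·α·γ̄) − χ(n₂·n̄₁), where R_q(a) = Σ_{z=1}^{q−1} e(az/q) is the Ramanujan sum and all inverses are taken modulo q. -/
open Finset
open scoped Classical

/-- `e x = exp(2πix)`. -/
noncomputable def e (x : ℝ) : ℂ := Complex.exp (2 * Real.pi * Complex.I * x)

/-- The sum of a nontrivial multiplicative character along an affine map of a finite field. -/
theorem MulChar.sum_add_mul {F R : Type*} [Field F] [Fintype F] [DecidableEq F]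
    [CommRing R] [IsDomain R] {χ : MulChar F R} (hχ : χ ≠ 1) (c d : F) :
    ∑ u, χ (c + d * u) = if d = 0 then (Fintype.card F : R) * χ c else 0 := by
  split_ifs with hd
  · simp [hd]
  · rw [← MulChar.sum_eq_zero_of_ne_one hχ]
    exact Equiv.sum_comp ((Equiv.mulLeft₀ d hd).trans (Equiv.addLeft c)) χ

/-- The correlation of `χ⁻¹` and `χ` along two affine maps of a finite field. -/
theorem MulChar.sum_inv_add_mul_add_mul {F R : Type*} [Field F] [Fintype F] [DecidableEq F]
    [CommRing R] [IsDomain R] {χ : MulChar F R} (hχ : χ ≠ 1) (a b c : F) :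
    ∑ z, χ⁻¹ (a + z) * χ (b + c * z) =
      χ c * ((if b - a * c = 0 then (Fintype.card F : R) else 0) - 1) := by
  have term (w : F) : χ⁻¹ (a + (w - a)) * χ (b + c * (w - a)) =
      χ (c + (b - a * c) * w⁻¹) - if w = 0 then χ c else 0 := by
    rw [add_sub_cancel, MulChar.inv_apply', ← map_mul]
    by_cases hw : w = 0
    · simp [hw]
    · rw [if_neg hw, sub_zero]
      congr 1
      field_simp
      ring
  calc ∑ z, χ⁻¹ (a + z) * χ (b + c * z)
      = ∑ w, χ⁻¹ (a + (w - a)) * χ (b + c * (w - a)) :=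
        (Equiv.sum_comp (Equiv.subRight a) fun z ↦ χ⁻¹ (a + z) * χ (b + c * z)).symm
    _ = ∑ w, χ (c + (b - a * c) * w⁻¹) - χ c := by
        simp only [term, sum_sub_distrib, sum_ite_eq', mem_univ, if_true]
    _ = ∑ u, χ (c + (b - a * c) * u) - χ c := by
        congr 1
        exact Equiv.sum_comp (inv_involutive.toPerm (Inv.inv : F → F)) fun u ↦
          χ (c + (b - a * c) * u)
    _ = _ := by
        rw [MulChar.sum_add_mul hχ]
        split_ifs <;> ring

theorem e_val_div_eq_stdAddChar {q : ℕ} [NeZero q] (x : ZMod q) :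
    e ((x.val : ℝ) / (q : ℝ)) = ZMod.stdAddChar x := by
  rw [ZMod.stdAddChar_apply, ZMod.toCircle_apply, e]
  push_cast
  congr 1
  ring

/-- The value of the Ramanujan sum to a prime modulus. -/
theorem ramanujanSum_prime (q : ℕ) [Fact (Nat.Prime q)] (a : ZMod q) :
    ∑ z ∈ univ.filter (fun z : ZMod q => z ≠ 0), e (((a * z).val : ℝ) / (q : ℝ)) =
      (if a = 0 then (q : ℂ) else 0) - 1 := by
  have h := AddChar.sum_mulShift a (ZMod.isPrimitive_stdAddChar q)
  rw [← sum_erase_add _ _ (mem_univ 0), zero_mul, AddChar.map_zero_eq_one] at h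
  simp only [e_val_div_eq_stdAddChar, filter_ne', mul_comm a]
  rw [eq_sub_iff_add_eq, h]
  simp [ZMod.card]

/-- Let `q > 3` be prime, `χ` a nontrivial (hence primitive) Dirichlet character mod `q`,
and `m, n₁, n₂, α, γ` integers with `(αγ, q) = 1` and `(n₁n₂, q) = 1`.  If `q ∣ m`, then
`𝔠 = Σ_{z ∈ 𝔽_q^×, (m + γz̄, q)=1} χ̄(n₁ + z) χ(n₂ + α(m + γz̄)⁻¹)`
equals `χ(αγ̄) R_q(n₂ - n₁αγ̄) - χ(n₂n̄₁)`, where `R_q(a) = Σ_{z ∈ 𝔽_q^×} e(az/q)`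
is the Ramanujan sum. -/
theorem char_sum_q_dvd_m (q : ℕ) [Fact (Nat.Prime q)] (hq3 : 3 < q)
    (χ : DirichletCharacter ℂ q) (hχ : χ ≠ 1)
    (m n₁ n₂ α γ : ℤ)
    (hαγ : Int.gcd (α * γ) (q : ℤ) = 1)
    (hn : Int.gcd (n₁ * n₂) (q : ℤ) = 1)
    (hm : (q : ℤ) ∣ m) :
    (∑ z ∈ Finset.univ.filter
        (fun z : ZMod q => z ≠ 0 ∧ (m : ZMod q) + (γ : ZMod q) * z⁻¹ ≠ 0),
      star (χ ((n₁ : ZMod q) + z)) *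
        χ ((n₂ : ZMod q) + (α : ZMod q) * ((m : ZMod q) + (γ : ZMod q) * z⁻¹)⁻¹))
    = χ ((α : ZMod q) * ((γ : ZMod q))⁻¹) *
        (∑ z ∈ Finset.univ.filter (fun z : ZMod q => z ≠ 0),
          e (((((n₂ : ZMod q) - (n₁ : ZMod q) * (α : ZMod q) * ((γ : ZMod q))⁻¹) * z).val : ℝ)
            / (q : ℝ)))
      - χ ((n₂ : ZMod q) * ((n₁ : ZMod q))⁻¹) := by
  have hγ : (γ : ZMod q) ≠ 0 := by
    rw [Ne, ZMod.intCast_zmod_eq_zero_iff_dvd]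
    intro hdvd
    have := Int.gcd_eq_natAbs_right (hdvd.mul_left α)
    simp only [Int.natAbs_natCast] at this
    omega
  rw [(ZMod.intCast_zmod_eq_zero_iff_dvd m q).2 hm, ramanujanSum_prime]
  have hfilter : univ.filter (fun z : ZMod q => z ≠ 0 ∧ 0 + (γ : ZMod q) * z⁻¹ ≠ 0) =
      univ.erase 0 := by
    ext z
    simp [hγ]
  have h := MulChar.sum_inv_add_mul_add_mul hχ (n₁ : ZMod q) (n₂ : ZMod q)
    ((α : ZMod q) * (γ : ZMod q)⁻¹)
  rw [← sum_erase_add _ _ (mem_univ 0), ZMod.card, ← mul_assoc] at h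
  rw [← h, hfilter]
  simp only [MulChar.star_apply', MulChar.inv_apply', zero_add, add_zero, mul_zero, mul_inv,
    inv_inv, ← mul_assoc, map_mul, mul_comm (χ (n₂ : ZMod q)), add_sub_cancel_right]
end

section
/- Suppose q ∤ m, n₁ ≡ m̄·γ (mod q) and n₂ ≡ −m̄·α (mod q) (where m̄ is the inverse of m modulo q), and suppose χ is not a quadratic character (i.e. χ² is not the trivial character). Then 𝔠 = −χ(m·n₂·γ̄). -/
open Finset
open scoped Classical

/-- The sum of a nontrivial multiplicative character along an affine bijection vanishes. -/
lemma MulChar.sum_affine_eq_zero {F R : Type*} [Field F] [Fintype F] [CommRing R] [IsDomain R]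
    {ψ : MulChar F R} (hψ : ψ ≠ 1) {a : F} (ha : a ≠ 0) (b : F) :
    ∑ z, ψ (a * z + b) = 0 := by
  rw [← MulChar.sum_eq_zero_of_ne_one hψ]
  exact Fintype.sum_equiv ((Equiv.mulLeft₀ a ha).trans (Equiv.addRight b)) _ _ fun z => rfl

/-- Puncturing the sum in `MulChar.sum_affine_eq_zero` at `0`. -/
lemma MulChar.sum_affine_filter_eq {F R : Type*} [Field F] [Fintype F] [DecidableEq F]
    [CommRing R] [IsDomain R] {ψ : MulChar F R} (hψ : ψ ≠ 1) {a : F} (ha : a ≠ 0) (b : F) :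
    ∑ z ∈ Finset.univ.filter (fun z : F => z ≠ 0 ∧ a + b * z⁻¹ ≠ 0), ψ (a * z + b) = -ψ b := by
  have hsub : Finset.univ.filter (fun z : F => z ≠ 0 ∧ a + b * z⁻¹ ≠ 0) ⊆
      Finset.univ.erase 0 := fun z hz => by
    simpa using (Finset.mem_filter.1 hz).2.1
  rw [Finset.sum_subset hsub, eq_neg_iff_add_eq_zero]
  · have h := Finset.sum_erase_add Finset.univ (fun z => ψ (a * z + b)) (Finset.mem_univ 0)
    rw [MulChar.sum_affine_eq_zero hψ ha] at h
    simpa using h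
  · intro z hz hz'
    have hz0 : z ≠ 0 := Finset.ne_of_mem_erase hz
    have hw : a + b * z⁻¹ = 0 := by
      by_contra h
      exact hz' (by simp [hz0, h])
    have : a * z + b = 0 := by
      have : a * z + b = (a + b * z⁻¹) * z := by field_simp
      rw [this, hw, zero_mul]
    rw [this, MulChar.map_zero]

/-- Degenerate case, non-quadratic character: if `q ∤ m`, `n₁ ≡ m̄γ` and `n₂ ≡ -m̄α (mod q)`,
and `χ²` is not trivial, then `𝔠 = -χ(m n₂ γ̄)`. -/
theorem char_sum_degenerate_nonquadratic (q : ℕ) [Fact (Nat.Prime q)] (hq3 : 3 < q)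
    (χ : DirichletCharacter ℂ q) (hχ : χ ≠ 1)
    (m n₁ n₂ α γ : ℤ)
    (hαγ : Int.gcd (α * γ) (q : ℤ) = 1)
    (hn : Int.gcd (n₁ * n₂) (q : ℤ) = 1)
    (hm : ¬ ((q : ℤ) ∣ m))
    (h₁ : (n₁ : ZMod q) = ((m : ZMod q))⁻¹ * (γ : ZMod q))
    (h₂ : (n₂ : ZMod q) = -(((m : ZMod q))⁻¹ * (α : ZMod q)))
    (hquad : χ ^ 2 ≠ 1) :
    (∑ z ∈ Finset.univ.filter
        (fun z : ZMod q => z ≠ 0 ∧ (m : ZMod q) + (γ : ZMod q) * z⁻¹ ≠ 0),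
      star (χ ((n₁ : ZMod q) + z)) *
        χ ((n₂ : ZMod q) + (α : ZMod q) * ((m : ZMod q) + (γ : ZMod q) * z⁻¹)⁻¹))
    = - χ ((m : ZMod q) * (n₂ : ZMod q) * ((γ : ZMod q))⁻¹) := by
  have hm0 : (m : ZMod q) ≠ 0 := by rwa [Ne, ZMod.intCast_zmod_eq_zero_iff_dvd]
  have hγ0 : (γ : ZMod q) ≠ 0 := by
    rw [Ne, ZMod.intCast_zmod_eq_zero_iff_dvd]
    intro h
    have hdvd := Int.dvd_coe_gcd (h.mul_left α) dvd_rfl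
    rw [hαγ] at hdvd
    have := Nat.le_of_dvd one_pos (Int.natCast_dvd_natCast.1 hdvd)
    omega
  rw [h₁, h₂]
  generalize (m : ZMod q) = m at *
  generalize (γ : ZMod q) = γ at *
  generalize (α : ZMod q) = α at *
  have hterm : ∀ z ∈ Finset.univ.filter (fun z : ZMod q => z ≠ 0 ∧ m + γ * z⁻¹ ≠ 0),
      star (χ (m⁻¹ * γ + z)) * χ (-(m⁻¹ * α) + α * (m + γ * z⁻¹)⁻¹) =
        χ (-(α * γ)) * (χ ^ 2)⁻¹ (m * z + γ) := by
    intro z hz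
    obtain ⟨hz0, hw⟩ := (Finset.mem_filter.1 hz).2
    have hw' : m * z + γ ≠ 0 := by
      have : m * z + γ = (m + γ * z⁻¹) * z := by field_simp
      rw [this]
      exact mul_ne_zero hw hz0
    have hinv : (m + γ * z⁻¹)⁻¹ = z * (m * z + γ)⁻¹ := by
      have : m + γ * z⁻¹ = (m * z + γ) * z⁻¹ := by field_simp
      rw [this, mul_inv, inv_inv, mul_comm]
    rw [MulChar.star_apply', MulChar.inv_apply', MulChar.inv_apply',
      MulChar.pow_apply' _ two_ne_zero, ← map_pow, ← map_mul, ← map_mul, hinv]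
    congr 1
    have : m⁻¹ * γ + z = m⁻¹ * (m * z + γ) := by field_simp; ring
    rw [this]
    field_simp
    ring
  rw [Finset.sum_congr rfl hterm, ← Finset.mul_sum,
    MulChar.sum_affine_filter_eq (inv_ne_one.2 hquad) hm0, mul_neg, MulChar.inv_apply',
    MulChar.pow_apply' _ two_ne_zero, ← map_pow, ← map_mul]
  congr 2
  field_simp
end

section
/- Let q be a prime, χ a primitive Dirichlet character modulo q, and c a positive integer with q² ∤ c. Set c_q = c/gcd(c, q) and q_c = q/gcd(c, q), and let A, n be integers with gcd(A, c) = 1. Then the complete sum Σ_{β mod [c,q]} χ(β)·e(−Aβ/c)·e(nβ/[c,q]) vanishes unless n ≡ A·q_c (mod c_q), in which case it equals c_q · χ̄((n − A·q_c)·\overline{c_q}) · g_χ, where \overline{c_q} is the multiplicative inverse of c_q modulo q and g_χ = Σ_{x mod q} χ(x)·e(x/q) is the Gauss sum. -/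
open Finset

lemma e_add (x y : ℝ) : e (x + y) = e x * e y := by
  simp only [e, ← Complex.exp_add]
  congr 1
  push_cast
  ring

lemma e_int_div_eq_stdAddChar (m : ℕ) [NeZero m] (k : ℤ) :
    e ((k : ℝ) / (m : ℝ)) = ZMod.stdAddChar (k : ZMod m) := by
  rw [ZMod.stdAddChar_coe, e]
  congr 1
  push_cast
  ring

lemma sum_zmod_eq_sum_range {R : Type*} [AddCommMonoid R] (m : ℕ) [NeZero m] (f : ZMod m → R) :
    ∑ x : ZMod m, f x = ∑ i ∈ range m, f (i : ZMod m) := by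
  refine Finset.sum_bij' (fun x _ => x.val) (fun i _ => (i : ZMod m)) ?_ ?_ ?_ ?_ ?_
  · intro x _
    exact mem_range.mpr (ZMod.val_lt x)
  · simp
  · simp
  · intro i hi
    exact ZMod.val_cast_of_lt (mem_range.mp hi)
  · simp

lemma sum_range_mul_eq_sum_sum {R : Type*} [AddCommMonoid R] (m q : ℕ) (f : ℕ → R) :
    ∑ i ∈ range (m * q), f i = ∑ x ∈ range q, ∑ y ∈ range m, f (x + q * y) := by
  rw [Finset.sum_comm]
  induction m with
  | zero => simp
  | succ m ih =>
    rw [Nat.succ_mul, sum_range_add, ih, sum_range_succ]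
    congr 1
    refine sum_congr rfl fun x _ => ?_
    rw [add_comm, mul_comm]

lemma sum_e_int_mul_div (m : ℕ) [NeZero m] (k : ℤ) :
    ∑ y ∈ range m, e (((k * (y : ℤ) : ℤ) : ℝ) / (m : ℝ)) =
      if (k : ZMod m) = 0 then (m : ℂ) else 0 := by
  have h := AddChar.sum_mulShift (k : ZMod m) (ZMod.isPrimitive_stdAddChar m)
  rw [sum_zmod_eq_sum_range, ZMod.card] at h
  simp only [e_int_div_eq_stdAddChar]
  push_cast at h ⊢
  rw [← h]
  exact sum_congr rfl fun y _ => by rw [mul_comm]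

/-- The sum of a primitive character twisted by an additive character whose modulus is `m q`,
with `m` prime to `q`. -/
lemma sum_char_mul_e_div (q m : ℕ) [NeZero q] [NeZero m] (hmq : m.Coprime q)
    (χ : DirichletCharacter ℂ q) (hχ : χ.IsPrimitive) (k : ℤ) :
    ∑ β ∈ range (m * q), χ (β : ZMod q) * e (((k * (β : ℤ) : ℤ) : ℝ) / ((m * q : ℕ) : ℝ)) =
      if (k : ZMod m) = 0 then
        (m : ℂ) * star (χ ((k : ZMod q) * (m : ZMod q)⁻¹)) *
          ∑ x : ZMod q, χ x * e ((x.val : ℝ) / (q : ℝ))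
      else 0 := by
  have hm : (m : ℝ) ≠ 0 := NeZero.ne _
  have hq : (q : ℝ) ≠ 0 := NeZero.ne _
  have split : ∀ x y : ℕ,
      χ ((x + q * y : ℕ) : ZMod q) *
          e (((k * ((x + q * y : ℕ) : ℤ) : ℤ) : ℝ) / ((m * q : ℕ) : ℝ)) =
        χ (x : ZMod q) * e (((k * (x : ℤ) : ℤ) : ℝ) / ((m * q : ℕ) : ℝ)) *
          e (((k * (y : ℤ) : ℤ) : ℝ) / (m : ℝ)) := by
    intro x y
    rw [mul_assoc, ← e_add]
    congr 2
    · simp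
    · push_cast
      field_simp
  rw [sum_range_mul_eq_sum_sum]
  simp only [split, ← Finset.mul_sum, sum_e_int_mul_div]
  split_ifs with hk
  · obtain ⟨l, rfl⟩ := (ZMod.intCast_zmod_eq_zero_iff_dvd k m).mp hk
    have hl : (((m : ℤ) * l : ℤ) : ZMod q) * (m : ZMod q)⁻¹ = (l : ZMod q) := by
      push_cast
      rw [mul_right_comm, ZMod.coe_mul_inv_eq_one m hmq, one_mul]
    have hg : ∑ x : ZMod q, χ x * e ((x.val : ℝ) / (q : ℝ)) = gaussSum χ ZMod.stdAddChar := by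
      refine sum_congr rfl fun x _ => ?_
      have h := e_int_div_eq_stdAddChar q (x.val : ℤ)
      simp only [Int.cast_natCast, ZMod.natCast_zmod_val] at h
      rw [h]
    have hs := gaussSum_mulShift_of_isPrimitive (ZMod.stdAddChar (N := q)) hχ (l : ZMod q)
    rw [hl, hg, MulChar.star_apply', mul_assoc, ← hs, ← Finset.sum_mul, mul_comm, gaussSum,
      sum_zmod_eq_sum_range]
    congr 1
    refine sum_congr rfl fun x _ => ?_
    rw [AddChar.mulShift_apply]
    have h := e_int_div_eq_stdAddChar q (l * x)
    push_cast at h ⊢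
    rw [← h]
    congr 2
    field_simp
  · simp

/-- Let `q` be prime, `χ` primitive mod `q`, and `c ≥ 1` with `q² ∤ c`.  Set
`c_q = c/(c,q)` and `q_c = q/(c,q)`, and let `A, n` be integers with `(A, c) = 1`.
Then `Σ_{β mod [c,q]} χ(β) e(-Aβ/c) e(nβ/[c,q])` vanishes unless
`n ≡ A q_c (mod c_q)`, in which case it equals `c_q χ̄((n - A q_c) c̄_q) g_χ`,
where `g_χ = Σ_{x mod q} χ(x) e(x/q)` is the Gauss sum. -/
theorem complete_char_sum_eval (q : ℕ) [Fact (Nat.Prime q)]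
    (χ : DirichletCharacter ℂ q) (hχ : χ.IsPrimitive)
    (c : ℕ) (hc : 0 < c) (hc2 : ¬ (q ^ 2 ∣ c))
    (A n : ℤ) (hA : Int.gcd A (c : ℤ) = 1) :
    ∑ β ∈ Finset.range (Nat.lcm c q),
      χ ((β : ZMod q)) * e ((-(A * (β : ℤ)) : ℝ) / (c : ℝ)) *
        e (((n * (β : ℤ)) : ℝ) / ((Nat.lcm c q : ℕ) : ℝ))
    = if ((n : ZMod (c / Nat.gcd c q))
            = ((A * ((q / Nat.gcd c q : ℕ) : ℤ) : ℤ) : ZMod (c / Nat.gcd c q)))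
      then ((c / Nat.gcd c q : ℕ) : ℂ) *
            star (χ (((n - A * ((q / Nat.gcd c q : ℕ) : ℤ) : ℤ) : ZMod q) *
              (((c / Nat.gcd c q : ℕ) : ZMod q))⁻¹)) *
            (∑ x : ZMod q, χ x * e ((x.val : ℝ) / (q : ℝ)))
      else 0 := by
  have hq : q.Prime := Fact.out
  set d := Nat.gcd c q with hd
  have hd0 : 0 < d := Nat.gcd_pos_of_pos_left _ hc
  have hdc : d * (c / d) = c := Nat.mul_div_cancel' (Nat.gcd_dvd_left c q)
  have hdq : d * (q / d) = q := Nat.mul_div_cancel' (Nat.gcd_dvd_right c q)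
  set m := c / d with hm
  set r := q / d with hr
  have hm0 : m ≠ 0 := by
    rintro h
    rw [h] at hdc
    omega
  have : NeZero m := ⟨hm0⟩
  have hlcm : Nat.lcm c q = m * q := by
    refine Nat.eq_of_mul_eq_mul_left hd0 ?_
    rw [hd, Nat.gcd_mul_lcm, ← hd, ← mul_assoc, hdc]
  have hmq : m.Coprime q := by
    refine ((Nat.Prime.coprime_iff_not_dvd hq).mpr fun hqm => hc2 ?_).symm
    have hqc : q ∣ c := hdc ▸ hqm.mul_left d
    have hdq' : d = q := Nat.gcd_eq_right hqc
    rw [← hdc, hdq', sq]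
    exact mul_dvd_mul_left q hqm
  have hcond : ((n : ZMod m) = ((A * (r : ℤ) : ℤ) : ZMod m)) ↔
      ((n - A * (r : ℤ) : ℤ) : ZMod m) = 0 := by
    rw [Int.cast_sub, sub_eq_zero]
  rw [hlcm]
  simp only [hcond]
  rw [← sum_char_mul_e_div q m hmq χ hχ]
  refine sum_congr rfl fun β _ => ?_
  rw [mul_assoc, ← e_add]
  congr 2
  have hm' : (m : ℝ) ≠ 0 := Nat.cast_ne_zero.mpr hm0
  have hd' : (d : ℝ) ≠ 0 := Nat.cast_ne_zero.mpr hd0.ne'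
  have hq' : (q : ℝ) ≠ 0 := Nat.cast_ne_zero.mpr hq.ne_zero
  have hc' : (c : ℝ) = d * m := by exact_mod_cast hdc.symm
  have hqd : (d : ℝ) * r = q := by exact_mod_cast hdq
  rw [hc']
  push_cast
  field_simp
  rw [← hqd]
  ring
end
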